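/- arXiv:1703.02663 — 5 statements merged into one kernel-verified Lean document; each statement's English description precedes it below -/
import Mathlib

section
/- Let E be a cancellative (integral) commutative monoid, G a subgroup of the group Eˣ of units of E, and π : E →* P a surjective monoid homomorphism onto a commutative monoid P such that for all x, y ∈ E one has π(x) = π(y) if and only if there exists u ∈ G with y = u·x (i.e., E is a G-torsor over P). If P is finitely generated, cancellative and torsion-free, then π admits a monoid-homomorphism section: there exists a monoid homomorphism s : P →* E with π ∘ s = id_P. -/
/-- Every element of a Grothendieck group is a quotient of elements of the monoid. -/
theorem Algebra.GrothendieckGroup.exists_mul_of_eq_of {M : Type*} [CommMonoid M]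
    (x : Algebra.GrothendieckGroup M) :
    ∃ a b : M, x * Algebra.GrothendieckGroup.of b = Algebra.GrothendieckGroup.of a := by
  obtain ⟨⟨a, b⟩, h⟩ := (Localization.monoidOf (⊤ : Submonoid M)).surj x
  exact ⟨a, b, h⟩

/-- A surjection of commutative groups onto a finitely generated torsion-free one splits. -/
theorem MonoidHom.exists_section_of_fg_of_isMulTorsionFree {A B : Type*} [CommGroup A]
    [CommGroup B] [Group.FG B] [IsMulTorsionFree B] (f : A →* B)
    (hf : Function.Surjective f) : ∃ σ : B →* A, ∀ b, f (σ b) = b := by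
  have : Module.Finite ℤ (Additive B) := Module.Finite.iff_addGroup_fg.mpr inferInstance
  obtain ⟨g, hg⟩ := Module.projective_lifting_property
    (MonoidHom.toAdditive f).toIntLinearMap (LinearMap.id (R := ℤ) (M := Additive B)) hf
  exact ⟨MonoidHom.toAdditive.symm g.toAddMonoidHom, fun b => LinearMap.congr_fun hg b⟩

/-- Let `E` be a cancellative commutative monoid, `G` a subgroup of the
group `Eˣ` of units of `E`, and `π : E →* P` a surjective monoid homomorphism onto a
commutative monoid `P` such that `π x = π y` iff `y = u * x` for some `u ∈ G`
(i.e. `E` is a `G`-torsor over `P`).  If `P` is finitely generated, cancellative and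
torsion-free, then `π` admits a section which is a monoid homomorphism. -/
theorem monoid_torsor_section_exists
    {E P : Type*} [CommMonoid E] [IsCancelMul E] [CommMonoid P] [IsCancelMul P]
    (G : Subgroup Eˣ) (π : E →* P)
    (hsurj : Function.Surjective π)
    (htorsor : ∀ x y : E, π x = π y ↔ ∃ u ∈ G, y = (u : Eˣ) * x)
    (hfg : Monoid.FG P)
    (htf : ∀ n : ℕ, 1 ≤ n → ∀ a b : P, a ^ n = b ^ n → a = b) :
    ∃ s : P →* E, π.comp s = MonoidHom.id P := by
  have : IsMulTorsionFree P := ⟨fun n hn a b h => htf n (Nat.one_le_iff_ne_zero.mpr hn) a b h⟩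
  have : Group.FG (Algebra.GrothendieckGroup P) := Group.fg_iff_monoid_fg.mpr inferInstance
  let f : Algebra.GrothendieckGroup E →* Algebra.GrothendieckGroup P :=
    Algebra.GrothendieckGroup.lift (Algebra.GrothendieckGroup.of.comp π)
  have hf (e : E) : f (Algebra.GrothendieckGroup.of e) = Algebra.GrothendieckGroup.of (π e) :=
    DFunLike.congr_fun (Algebra.GrothendieckGroup.lift.symm_apply_apply
      (Algebra.GrothendieckGroup.of.comp π)) e
  have hf_surj : Function.Surjective f := fun y => by
    obtain ⟨p, q, h⟩ := Algebra.GrothendieckGroup.exists_mul_of_eq_of y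
    obtain ⟨a, rfl⟩ := hsurj p
    obtain ⟨b, rfl⟩ := hsurj q
    exact ⟨Algebra.GrothendieckGroup.of a / Algebra.GrothendieckGroup.of b, by
      rw [map_div, hf, hf, div_eq_iff_eq_mul, h]⟩
  obtain ⟨σ, hσ⟩ := f.exists_section_of_fg_of_isMulTorsionFree hf_surj
  have hlift (p : P) : ∃ e : E,
      Algebra.GrothendieckGroup.of e = σ (Algebra.GrothendieckGroup.of p) ∧ π e = p := by
    obtain ⟨a, b, h⟩ := Algebra.GrothendieckGroup.exists_mul_of_eq_of
      (σ (Algebra.GrothendieckGroup.of p))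
    obtain ⟨e, rfl⟩ := hsurj p
    have hπ : π (e * b) = π a := by
      apply Algebra.GrothendieckGroup.of_injective
      rw [map_mul, map_mul, ← hf a, ← h, map_mul, hσ, hf]
    obtain ⟨u, hu, rfl⟩ := (htorsor _ _).mp hπ
    refine ⟨u * e, ?_, ((htorsor _ _).mpr ⟨u, hu, rfl⟩).symm⟩
    rw [← mul_assoc, map_mul _ _ b] at h
    exact (mul_right_cancel h).symm
  choose s hs hπs using hlift
  refine ⟨⟨⟨s, ?_⟩, fun p q => ?_⟩, MonoidHom.ext hπs⟩
  · apply Algebra.GrothendieckGroup.of_injective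
    rw [hs, map_one, map_one, map_one]
  · apply Algebra.GrothendieckGroup.of_injective
    rw [hs, map_mul, map_mul, map_mul]
    exact (congrArg₂ (· * ·) (hs p) (hs q)).symm
end

section
/- Let E be a cancellative commutative monoid, G a subgroup of the group Eˣ of units of E, and π : E →* P a surjective monoid homomorphism onto a cancellative commutative monoid P such that for all x, y ∈ E one has π(x) = π(y) if and only if there exists u ∈ G with y = u·x. Let ι_E : E →* H and ι_P : P →* K be groupifications of E and P respectively, and let π̄ : H →* K be a group homomorphism with π̄ ∘ ι_E = ι_P ∘ π. Then π̄ is surjective and its kernel is exactly the image of G under ι_E, i.e., the sequence 1 → G → H → K → 1 is exact. -/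
/-- Let `E` be a cancellative commutative monoid, `G` a subgroup of `Eˣ`,
and `π : E →* P` a surjective monoid homomorphism onto a cancellative commutative monoid `P`
such that `π x = π y` iff `y = u * x` for some `u ∈ G`.  Let `ιE : E →* H` and `ιP : P →* K`
be groupifications, and `πbar : H →* K` a group homomorphism with `πbar ∘ ιE = ιP ∘ π`.
Then `πbar` is surjective and its kernel is exactly the image of `G` under `ιE`:
the sequence `1 → G → H → K → 1` is exact. -/
theorem torsor_groupification_exact
    {E P H K : Type*} [CommMonoid E] [IsCancelMul E] [CommMonoid P] [IsCancelMul P]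
    [CommGroup H] [CommGroup K]
    (G : Subgroup Eˣ) (π : E →* P)
    (hsurj : Function.Surjective π)
    (htorsor : ∀ x y : E, π x = π y ↔ ∃ u ∈ G, y = (u : Eˣ) * x)
    (ιE : E →* H) (hEinj : Function.Injective ιE)
    (hEgen : ∀ h : H, ∃ a b : E, h = ιE a * (ιE b)⁻¹)
    (ιP : P →* K) (hPinj : Function.Injective ιP)
    (hPgen : ∀ k : K, ∃ a b : P, k = ιP a * (ιP b)⁻¹)
    (πbar : H →* K) (hcomp : πbar.comp ιE = ιP.comp π) :
    Function.Surjective πbar ∧ ∀ h : H, πbar h = 1 ↔ ∃ u ∈ G, h = ιE (u : Eˣ) := by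
  have hcomm (x : E) : πbar (ιE x) = ιP (π x) := DFunLike.congr_fun hcomp x
  refine ⟨fun k => ?_, fun h => ⟨fun hh => ?_, ?_⟩⟩
  · obtain ⟨a, b, rfl⟩ := hPgen k
    obtain ⟨x, rfl⟩ := hsurj a
    obtain ⟨y, rfl⟩ := hsurj b
    exact ⟨ιE x * (ιE y)⁻¹, by rw [map_mul, map_inv, hcomm, hcomm]⟩
  · obtain ⟨a, b, rfl⟩ := hEgen h
    rw [map_mul, map_inv, hcomm, hcomm, mul_inv_eq_one] at hh
    obtain ⟨u, hu, rfl⟩ := (htorsor b a).1 (hPinj hh).symm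
    exact ⟨u, hu, by rw [map_mul, mul_inv_cancel_right]⟩
  · rintro ⟨u, hu, rfl⟩
    have hπu : π 1 = π u := (htorsor 1 u).2 ⟨u, hu, (mul_one _).symm⟩
    rw [hcomm, ← hπu, map_one, map_one]
end

section
/- Let E be a cancellative commutative monoid, G a subgroup of the group Eˣ of units of E, and π : E →* P a surjective monoid homomorphism onto a cancellative commutative monoid P such that for all x, y ∈ E one has π(x) = π(y) if and only if there exists u ∈ G with y = u·x. Let ι_E : E →* H and ι_P : P →* K be groupifications, and π̄ : H →* K a group homomorphism with π̄ ∘ ι_E = ι_P ∘ π. Then E is the inverse image of P inside H: for every h ∈ H, if π̄(h) lies in the image of ι_P, then h lies in the image of ι_E. -/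
/-- With `E` a cancellative commutative monoid, `G` a subgroup of `Eˣ`,
`π : E →* P` surjective onto a cancellative commutative monoid `P` making `E` a `G`-torsor
over `P`, and groupifications `ιE : E →* H`, `ιP : P →* K` together with `πbar : H →* K`
satisfying `πbar ∘ ιE = ιP ∘ π`:  `E` is the inverse image of `P` inside `H`, i.e. any
`h : H` whose image `πbar h` lies in the image of `ιP` lies itself in the image of `ιE`. -/
theorem torsor_groupification_preimage
    {E P H K : Type*} [CommMonoid E] [IsCancelMul E] [CommMonoid P] [IsCancelMul P]
    [CommGroup H] [CommGroup K]
    (G : Subgroup Eˣ) (π : E →* P)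
    (hsurj : Function.Surjective π)
    (htorsor : ∀ x y : E, π x = π y ↔ ∃ u ∈ G, y = (u : Eˣ) * x)
    (ιE : E →* H) (hEinj : Function.Injective ιE)
    (hEgen : ∀ h : H, ∃ a b : E, h = ιE a * (ιE b)⁻¹)
    (ιP : P →* K) (hPinj : Function.Injective ιP)
    (hPgen : ∀ k : K, ∃ a b : P, k = ιP a * (ιP b)⁻¹)
    (πbar : H →* K) (hcomp : πbar.comp ιE = ιP.comp π) :
    ∀ h : H, (∃ p : P, πbar h = ιP p) → ∃ e : E, h = ιE e := by
  rintro h ⟨p, hp⟩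
  obtain ⟨a, b, rfl⟩ := hEgen h
  obtain ⟨e, rfl⟩ := hsurj p
  have hπ (x : E) : πbar (ιE x) = ιP (π x) := DFunLike.congr_fun hcomp x
  have hab : π (e * b) = π a := by
    apply hPinj
    rw [map_mul, map_inv, hπ, hπ, mul_inv_eq_iff_eq_mul] at hp
    rw [map_mul, map_mul, hp]
  obtain ⟨u, -, rfl⟩ := (htorsor _ _).1 hab
  exact ⟨u * e, by rw [← mul_assoc, map_mul ιE (u * e) b, mul_inv_cancel_right]⟩
end

section
/- Let X be a topological space and F a sheaf of commutative monoids on X. Then F(U) is a sharp monoid for every open subset U of X if and only if the stalk F_x is a sharp monoid for every point x of X. -/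
open CategoryTheory Limits TopologicalSpace Opposite

noncomputable instance (J : Type) [SmallCategory J] [IsFiltered J] :
    HasColimitsOfShape J CommMonCat.{0} :=
  ⟨fun F => HasColimit.mk ⟨CommMonCat.FilteredColimits.colimitCocone F,
    CommMonCat.FilteredColimits.colimitCoconeIsColimit F⟩⟩

/-- The stalk of a sheaf of commutative monoids on a topological space at a point:
the filtered colimit of the sections over the open neighbourhoods of the point. -/
noncomputable def sheafStalk (X : TopCat.{0}) (F : TopCat.Sheaf CommMonCat.{0} X) (x : X) :
    CommMonCat :=
  colimit ((OpenNhds.inclusion x).op ⋙ F.val)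

theorem commMonCat_colimit_sharp {J : Type} [SmallCategory J] [IsFiltered J]
    (G : J ⥤ CommMonCat.{0}) (h : ∀ j, ∀ a b : G.obj j, a * b = 1 → a = 1)
    (a b : (colimit G : CommMonCat.{0})) (hab : a * b = 1) : a = 1 := by
  obtain ⟨i, s, rfl⟩ := Concrete.colimit_exists_rep G a
  obtain ⟨j, t, rfl⟩ := Concrete.colimit_exists_rep G b
  let k := IsFiltered.max i j
  have hs : colimit.ι G k (G.map (IsFiltered.leftToMax i j) s) = colimit.ι G i s :=
    ConcreteCategory.congr_hom (colimit.w G (IsFiltered.leftToMax i j)) s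
  have ht : colimit.ι G k (G.map (IsFiltered.rightToMax i j) t) = colimit.ι G j t :=
    ConcreteCategory.congr_hom (colimit.w G (IsFiltered.rightToMax i j)) t
  rw [← hs, ← ht, ← map_mul, ← map_one (colimit.ι G k).hom] at hab
  obtain ⟨l, f, g, hfg⟩ := Concrete.colimit_exists_of_rep_eq G _ _ hab
  rw [map_mul, map_one] at hfg
  rw [← hs, ← colimit.w G f, ConcreteCategory.comp_apply, h l _ _ hfg, map_one]

theorem exists_map_eq_one_of_colimit_sharp {J : Type} [SmallCategory J] [IsFiltered J]
    (G : J ⥤ CommMonCat.{0}) (h : ∀ a b : (colimit G : CommMonCat.{0}), a * b = 1 → a = 1)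
    (j : J) (a b : G.obj j) (hab : a * b = 1) : ∃ (k : J) (f : j ⟶ k), G.map f a = 1 := by
  have hι : colimit.ι G j a = colimit.ι G j 1 := by
    rw [map_one]
    exact h _ (colimit.ι G j b) (by rw [← map_mul, hab, map_one])
  obtain ⟨k, f, g, hfg⟩ := Concrete.colimit_exists_of_rep_eq G _ _ hι
  exact ⟨k, f, hfg.trans (map_one (G.map g).hom)⟩

/-- For a sheaf of commutative monoids `F` on a topological space `X`,
all monoids of sections `F(U)` are sharp (the only unit is the identity) if and only if
all stalks `F_x` are sharp. -/
theorem sheaf_sections_sharp_iff_stalks_sharp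
    (X : TopCat.{0}) (F : TopCat.Sheaf CommMonCat.{0} X) :
    (∀ U : Opens X, ∀ a b : F.val.obj (op U), a * b = 1 → a = 1) ↔
    (∀ x : X, ∀ a b : sheafStalk X F x, a * b = 1 → a = 1) := by
  refine ⟨fun h x => commMonCat_colimit_sharp _ fun V => h _, fun h U a b hab => ?_⟩
  have key (x : U) : ∃ (V : Opens X) (i : V ⟶ U), x.1 ∈ V ∧ F.obj.map i.op a = 1 := by
    obtain ⟨W, f, hf⟩ := exists_map_eq_one_of_colimit_sharp _ (h x.1) (op ⟨U, x.2⟩) a b hab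
    exact ⟨W.unop.1, (OpenNhds.inclusion x.1).map f.unop, W.unop.2, hf⟩
  choose V i hxV hV using key
  refine TopCat.Sheaf.eq_of_locally_eq' F V U i (fun x hx => ?_) a 1 fun x => ?_
  · exact Opens.mem_iSup.mpr ⟨⟨x, hx⟩, hxV _⟩
  · exact (hV x).trans (map_one (F.obj.map (i x).op).hom).symm
end

section
/- Let X be a topological space and F a sheaf of commutative monoids on X such that the stalk F_x is cancellative for every point x of X. Then F(U) is a saturated monoid for every open subset U of X if and only if the stalk F_x is a saturated monoid for every point x of X. -/
open CategoryTheory Limits TopologicalSpace Opposite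

namespace TopCat.Sheaf

variable {X : TopCat.{0}} (F : TopCat.Sheaf CommMonCat.{0} X)

/-- The germ at `x` of a section over an open neighbourhood of `x`, as a monoid homomorphism. -/
noncomputable def sheafGerm {U : Opens X} {x : X} (hx : x ∈ U) :
    F.obj.obj (op U) →* sheafStalk X F x :=
  (colimit.ι ((OpenNhds.inclusion x).op ⋙ F.obj) (op ⟨U, hx⟩)).hom

/-- The restriction of sections to a smaller open subset, as a monoid homomorphism. -/
def restrict {U V : Opens X} (h : V ≤ U) : F.obj.obj (op U) →* F.obj.obj (op V) :=
  (F.obj.map (homOfLE h).op).hom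

lemma sheafGerm_restrict {U V : Opens X} (h : V ≤ U) {x : X} (hx : x ∈ V) (s : F.obj.obj (op U)) :
    F.sheafGerm hx (F.restrict h s) = F.sheafGerm (h hx) s :=
  ConcreteCategory.congr_hom (colimit.w ((OpenNhds.inclusion x).op ⋙ F.obj)
    (homOfLE h : (⟨V, hx⟩ : OpenNhds x) ⟶ ⟨U, h hx⟩).op) s

lemma restrict_restrict {U V W : Opens X} (h : V ≤ U) (k : W ≤ V) (s : F.obj.obj (op U)) :
    F.restrict k (F.restrict h s) = F.restrict (k.trans h) s :=
  (ConcreteCategory.congr_hom (F.obj.map_comp (homOfLE h).op (homOfLE k).op) s).symm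

lemma exists_sheafGerm_eq {x : X} (t : sheafStalk X F x) :
    ∃ (U : Opens X) (hx : x ∈ U) (s : F.obj.obj (op U)), F.sheafGerm hx s = t := by
  obtain ⟨j, s, hs⟩ := Concrete.isColimit_exists_rep _
    (colimit.isColimit ((OpenNhds.inclusion x).op ⋙ F.obj)) t
  exact ⟨j.unop.1, j.unop.2, s, hs⟩

lemma exists_restrict_eq {U : Opens X} {x : X} (hx : x ∈ U) {s t : F.obj.obj (op U)}
    (h : F.sheafGerm hx s = F.sheafGerm hx t) :
    ∃ (V : Opens X) (hVU : V ≤ U), x ∈ V ∧ F.restrict hVU s = F.restrict hVU t := by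
  let j : (OpenNhds x)ᵒᵖ := op ⟨U, hx⟩
  obtain ⟨k, f, g, hfg⟩ := Concrete.isColimit_exists_of_rep_eq (i := j) (j := j) _
    (colimit.isColimit ((OpenNhds.inclusion x).op ⋙ F.obj)) s t h
  exact ⟨k.unop.1, f.unop.le, k.unop.2, hfg⟩

lemma eq_of_sheafGerm_eq {U : Opens X} {s t : F.obj.obj (op U)}
    (h : ∀ (x : X) (hx : x ∈ U), F.sheafGerm hx s = F.sheafGerm hx t) : s = t := by
  choose V hVU hxV hV using fun x : U ↦ F.exists_restrict_eq x.2 (h x.1 x.2)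
  exact F.eq_of_locally_eq' V U (fun x ↦ homOfLE (hVU x))
    (fun x hx ↦ Opens.mem_iSup.mpr ⟨⟨x, hx⟩, hxV _⟩) s t hV

lemma exists_eq_mul_of_sheafGerm
    (hcancel : ∀ x : X, ∀ a b c : sheafStalk X F x, a * c = b * c → a = b)
    {U : Opens X} {a b : F.obj.obj (op U)}
    (h : ∀ (x : X) (hx : x ∈ U), ∃ d, F.sheafGerm hx a = F.sheafGerm hx b * d) :
    ∃ d, a = b * d := by
  have hloc (x : U) : ∃ (V : Opens X) (hVU : V ≤ U) (d : F.obj.obj (op V)),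
      x.1 ∈ V ∧ F.restrict hVU a = F.restrict hVU b * d := by
    obtain ⟨t, ht⟩ := h x.1 x.2
    obtain ⟨W, hxW, d, rfl⟩ := F.exists_sheafGerm_eq t
    have hx : x.1 ∈ U ⊓ W := ⟨x.2, hxW⟩
    obtain ⟨V, hV, hxV, heq⟩ := F.exists_restrict_eq hx
      (s := F.restrict inf_le_left a) (t := F.restrict inf_le_left b * F.restrict inf_le_right d)
      (by simpa only [map_mul, sheafGerm_restrict] using ht)
    refine ⟨V, hV.trans inf_le_left, F.restrict (hV.trans inf_le_right) d, hxV, ?_⟩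
    simpa only [map_mul, restrict_restrict] using heq
  choose V hVU d hxV hd using hloc
  have hgerm (i : U) (y : X) (hy : y ∈ V i) :
      F.sheafGerm (hVU i hy) a = F.sheafGerm (hVU i hy) b * F.sheafGerm hy (d i) := by
    simpa only [map_mul, sheafGerm_restrict] using congrArg (F.sheafGerm hy) (hd i)
  obtain ⟨e, he, -⟩ := F.existsUnique_gluing' V U (fun x ↦ homOfLE (hVU x))
    (fun x hx ↦ Opens.mem_iSup.mpr ⟨⟨x, hx⟩, hxV _⟩) d fun i j ↦ by
      change F.restrict inf_le_left (d i) = F.restrict inf_le_right (d j)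
      refine F.eq_of_sheafGerm_eq fun y hy ↦ ?_
      simp only [sheafGerm_restrict]
      refine hcancel y _ _ (F.sheafGerm (hVU i hy.1) b) ?_
      rw [mul_comm, ← hgerm i y hy.1, mul_comm, ← hgerm j y hy.2]
  refine ⟨e, F.eq_of_sheafGerm_eq fun x hx ↦ ?_⟩
  have hex : F.restrict (hVU ⟨x, hx⟩) e = d ⟨x, hx⟩ := he ⟨x, hx⟩
  rw [map_mul, hgerm ⟨x, hx⟩ x (hxV _), ← hex, sheafGerm_restrict]

/-- A relation `a ^ n = b ^ n * c` in a stalk lifts to a neighbourhood. -/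
lemma exists_sheafGerm_eq_of_pow_eq {x : X} {a b c : sheafStalk X F x} {n : ℕ}
    (h : a ^ n = b ^ n * c) :
    ∃ (U : Opens X) (hx : x ∈ U) (s t u : F.obj.obj (op U)),
      F.sheafGerm hx s = a ∧ F.sheafGerm hx t = b ∧ s ^ n = t ^ n * u := by
  obtain ⟨A, hA, s, rfl⟩ := F.exists_sheafGerm_eq a
  obtain ⟨B, hB, t, rfl⟩ := F.exists_sheafGerm_eq b
  obtain ⟨C, hC, u, rfl⟩ := F.exists_sheafGerm_eq c
  have hWA : A ⊓ B ⊓ C ≤ A := inf_le_left.trans inf_le_left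
  have hWB : A ⊓ B ⊓ C ≤ B := inf_le_left.trans inf_le_right
  have hWC : A ⊓ B ⊓ C ≤ C := inf_le_right
  have hx : x ∈ A ⊓ B ⊓ C := ⟨⟨hA, hB⟩, hC⟩
  obtain ⟨V, hV, hxV, heq⟩ := F.exists_restrict_eq hx
    (s := F.restrict hWA s ^ n) (t := F.restrict hWB t ^ n * F.restrict hWC u)
    (by simpa only [map_mul, map_pow, sheafGerm_restrict] using h)
  refine ⟨V, hxV, F.restrict (hV.trans hWA) s, F.restrict (hV.trans hWB) t,
    F.restrict (hV.trans hWC) u, F.sheafGerm_restrict _ _ _, F.sheafGerm_restrict _ _ _, ?_⟩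
  simpa only [map_mul, map_pow, restrict_restrict] using heq

end TopCat.Sheaf

/-- Let `F` be a sheaf of commutative monoids on a topological space `X`
whose stalks are all cancellative.  Then all monoids of sections `F(U)` are saturated if
and only if all stalks `F_x` are saturated.  (A cancellative commutative monoid `M` is
saturated if whenever `aⁿ = bⁿ * c` for some `c ∈ M` and `n ≥ 1`, there is `d ∈ M` with
`a = b * d`.) -/
theorem sheaf_sections_saturated_iff_stalks_saturated
    (X : TopCat.{0}) (F : TopCat.Sheaf CommMonCat.{0} X)
    (hcancel : ∀ x : X, ∀ a b c : sheafStalk X F x, a * c = b * c → a = b) :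
    (∀ U : Opens X, ∀ a b : F.val.obj (op U), ∀ n : ℕ, 1 ≤ n →
        (∃ c : F.val.obj (op U), a ^ n = b ^ n * c) → ∃ d : F.val.obj (op U), a = b * d) ↔
    (∀ x : X, ∀ a b : sheafStalk X F x, ∀ n : ℕ, 1 ≤ n →
        (∃ c : sheafStalk X F x, a ^ n = b ^ n * c) → ∃ d : sheafStalk X F x, a = b * d) := by
  constructor
  · rintro hsec x a b n hn ⟨c, hc⟩
    obtain ⟨U, hx, s, t, u, rfl, rfl, h⟩ := F.exists_sheafGerm_eq_of_pow_eq hc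
    obtain ⟨d, rfl⟩ := hsec U s t n hn ⟨u, h⟩
    exact ⟨F.sheafGerm hx d, map_mul _ _ _⟩
  · rintro hstalk U a b n hn ⟨c, hc⟩
    refine F.exists_eq_mul_of_sheafGerm hcancel fun x hx ↦
      hstalk x _ _ n hn ⟨F.sheafGerm hx c, ?_⟩
    simpa only [map_mul, map_pow] using congrArg (F.sheafGerm hx) hc
end
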